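/- arXiv:2306.13222 — 4 statements merged into one kernel-verified Lean document; each statement's English description precedes it below -/
import Mathlib

section
/- Per-factor distance lower bound: for every task index j, every product state (s, q), and every plan π that drives the full product from (s, q) to a fully accepting product state, the single-product distance d^j(s, q j) is at most the total cost of π. -/
open scoped NNReal

namespace Stmt2

/-- Product step on `S × (Π i, Q i)`. -/
def stepP {S A α : Type*} {N : ℕ} {Q : Fin N → Type*}
    (δ : S → A → S) (L : S → α) (step : ∀ i, Q i → α → Q i)
    (p : S × (∀ i, Q i)) (a : A) : S × (∀ i, Q i) :=
  (δ p.1 a, fun i => step i (p.2 i) (L (δ p.1 a)))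

/-- Executing a plan from a product state. -/
def runP {S A α : Type*} {N : ℕ} {Q : Fin N → Type*}
    (δ : S → A → S) (L : S → α) (step : ∀ i, Q i → α → Q i)
    (p : S × (∀ i, Q i)) (π : List A) : S × (∀ i, Q i) :=
  π.foldl (stepP δ L step) p

/-- Total cost of executing a plan from a product state. -/
def costP {S A α : Type*} {N : ℕ} {Q : Fin N → Type*}
    (δ : S → A → S) (L : S → α) (c : S → A → ℝ≥0) (step : ∀ i, Q i → α → Q i) :
    (S × (∀ i, Q i)) → List A → ℝ≥0
  | _, [] => 0
  | p, a :: π => c p.1 a + costP δ L c step (stepP δ L step p a) π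

/-- Single-product step on `S × Qj` for one task. -/
def step1 {S A α Qj : Type*} (δ : S → A → S) (L : S → α) (stepj : Qj → α → Qj)
    (p : S × Qj) (a : A) : S × Qj :=
  (δ p.1 a, stepj p.2 (L (δ p.1 a)))

/-- Executing a plan from a single-product state. -/
def run1 {S A α Qj : Type*} (δ : S → A → S) (L : S → α) (stepj : Qj → α → Qj)
    (p : S × Qj) (π : List A) : S × Qj :=
  π.foldl (step1 δ L stepj) p

/-- Total cost of executing a plan from a single-product state. -/
def cost1 {S A α Qj : Type*} (δ : S → A → S) (L : S → α) (c : S → A → ℝ≥0)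
    (stepj : Qj → α → Qj) : (S × Qj) → List A → ℝ≥0
  | _, [] => 0
  | p, a :: π => c p.1 a + cost1 δ L c stepj (step1 δ L stepj p a) π

/-- `d^j(s, qj)`: the infimum of total costs of plans driving the single product
from `(s, qj)` to a state whose automaton component is accepting. -/
noncomputable def dist1 {S A α Qj : Type*} (δ : S → A → S) (L : S → α)
    (c : S → A → ℝ≥0) (stepj : Qj → α → Qj) (Fj : Set Qj) (p : S × Qj) : ℝ≥0 :=
  sInf {x : ℝ≥0 | ∃ π : List A, (run1 δ L stepj p π).2 ∈ Fj ∧ cost1 δ L c stepj p π = x}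

theorem run1_eq_runP {S A α : Type*} {N : ℕ} {Q : Fin N → Type*}
    (δ : S → A → S) (L : S → α) (step : ∀ i, Q i → α → Q i) (j : Fin N) (π : List A) :
    ∀ p : S × (∀ i, Q i), run1 δ L (step j) (p.1, p.2 j) π =
      ((runP δ L step p π).1, (runP δ L step p π).2 j) := by
  induction π with
  | nil => intro p; rfl
  | cons a π ih => intro p; exact ih (stepP δ L step p a)

theorem cost1_eq_costP {S A α : Type*} {N : ℕ} {Q : Fin N → Type*}
    (δ : S → A → S) (L : S → α) (c : S → A → ℝ≥0) (step : ∀ i, Q i → α → Q i)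
    (j : Fin N) (π : List A) :
    ∀ p : S × (∀ i, Q i), cost1 δ L c (step j) (p.1, p.2 j) π = costP δ L c step p π := by
  induction π with
  | nil => intro p; rfl
  | cons a π ih =>
    intro p
    exact congrArg (fun x => c p.1 a + x) (ih (stepP δ L step p a))

/-- Per-factor distance lower bound: if plan `π` drives the full product from `(s, q)`
to a fully accepting product state, then for each task `j` the single-product distance
`d^j(s, q j)` is at most the total cost of `π`. -/
theorem per_factor_distance_lower_bound {S A α : Type*} {N : ℕ} {Q : Fin N → Type*}
    (δ : S → A → S) (L : S → α) (c : S → A → ℝ≥0)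
    (step : ∀ i, Q i → α → Q i) (F : ∀ i, Set (Q i))
    (j : Fin N) (s : S) (q : ∀ i, Q i) (π : List A)
    (hacc : ∀ i, (runP δ L step (s, q) π).2 i ∈ F i) :
    dist1 δ L c (step j) (F j) (s, q j) ≤ costP δ L c step (s, q) π := by
  refine csInf_le (OrderBot.bddBelow _) ⟨π, ?_, cost1_eq_costP δ L c step j π (s, q)⟩
  have h := run1_eq_runP δ L step j π (s, q)
  dsimp only at h
  rw [h]
  exact hacc j

end Stmt2
end

section
/- Admissibility of the max-min heuristic (Lemma 1): assume N ≥ 1 and define the heuristic h(s, q) as the maximum over all task indices j in Fin N of the single-product distances d^j(s, q j). Then for every product state (s, q) and every plan π that drives the full product from (s, q) to a fully accepting product state, h(s, q) is at most the total cost of π; that is, h under-estimates the minimum cost-to-go. -/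
open scoped NNReal

namespace Stmt3

/-- Product step on `S × (Π i, Q i)`. -/
def stepP {S A α : Type*} {N : ℕ} {Q : Fin N → Type*}
    (δ : S → A → S) (L : S → α) (step : ∀ i, Q i → α → Q i)
    (p : S × (∀ i, Q i)) (a : A) : S × (∀ i, Q i) :=
  (δ p.1 a, fun i => step i (p.2 i) (L (δ p.1 a)))

/-- Executing a plan from a product state. -/
def runP {S A α : Type*} {N : ℕ} {Q : Fin N → Type*}
    (δ : S → A → S) (L : S → α) (step : ∀ i, Q i → α → Q i)
    (p : S × (∀ i, Q i)) (π : List A) : S × (∀ i, Q i) :=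
  π.foldl (stepP δ L step) p

/-- Total cost of executing a plan from a product state. -/
def costP {S A α : Type*} {N : ℕ} {Q : Fin N → Type*}
    (δ : S → A → S) (L : S → α) (c : S → A → ℝ≥0) (step : ∀ i, Q i → α → Q i) :
    (S × (∀ i, Q i)) → List A → ℝ≥0
  | _, [] => 0
  | p, a :: π => c p.1 a + costP δ L c step (stepP δ L step p a) π

/-- Single-product step on `S × Qj` for one task. -/
def step1 {S A α Qj : Type*} (δ : S → A → S) (L : S → α) (stepj : Qj → α → Qj)
    (p : S × Qj) (a : A) : S × Qj :=
  (δ p.1 a, stepj p.2 (L (δ p.1 a)))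

/-- Executing a plan from a single-product state. -/
def run1 {S A α Qj : Type*} (δ : S → A → S) (L : S → α) (stepj : Qj → α → Qj)
    (p : S × Qj) (π : List A) : S × Qj :=
  π.foldl (step1 δ L stepj) p

/-- Total cost of executing a plan from a single-product state. -/
def cost1 {S A α Qj : Type*} (δ : S → A → S) (L : S → α) (c : S → A → ℝ≥0)
    (stepj : Qj → α → Qj) : (S × Qj) → List A → ℝ≥0
  | _, [] => 0
  | p, a :: π => c p.1 a + cost1 δ L c stepj (step1 δ L stepj p a) π

/-- `d^j(s, qj)`: the infimum of total costs of plans driving the single product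
from `(s, qj)` to a state whose automaton component is accepting. -/
noncomputable def dist1 {S A α Qj : Type*} (δ : S → A → S) (L : S → α)
    (c : S → A → ℝ≥0) (stepj : Qj → α → Qj) (Fj : Set Qj) (p : S × Qj) : ℝ≥0 :=
  sInf {x : ℝ≥0 | ∃ π : List A, (run1 δ L stepj p π).2 ∈ Fj ∧ cost1 δ L c stepj p π = x}


/-- The max-min heuristic: the maximum over all task indices `j` of the
single-product distances `d^j(s, q j)`. -/
noncomputable def maxMinHeuristic {S A α : Type*} {N : ℕ} {Q : Fin N → Type*}
    (δ : S → A → S) (L : S → α) (c : S → A → ℝ≥0)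
    (step : ∀ i, Q i → α → Q i) (F : ∀ i, Set (Q i))
    (p : S × (∀ i, Q i)) : ℝ≥0 :=
  Finset.univ.sup fun j : Fin N => dist1 δ L c (step j) (F j) (p.1, p.2 j)

theorem run1_eq_runP {S A α : Type*} {N : ℕ} {Q : Fin N → Type*}
    (δ : S → A → S) (L : S → α) (step : ∀ i, Q i → α → Q i) (j : Fin N) (π : List A) :
    ∀ p : S × (∀ i, Q i), run1 δ L (step j) (p.1, p.2 j) π =
      ((runP δ L step p π).1, (runP δ L step p π).2 j) := by
  induction π with
  | nil => intro p; rfl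
  | cons a π ih => intro p; exact ih (stepP δ L step p a)

theorem cost1_eq_costP {S A α : Type*} {N : ℕ} {Q : Fin N → Type*}
    (δ : S → A → S) (L : S → α) (c : S → A → ℝ≥0) (step : ∀ i, Q i → α → Q i)
    (j : Fin N) (π : List A) :
    ∀ p : S × (∀ i, Q i), cost1 δ L c (step j) (p.1, p.2 j) π = costP δ L c step p π := by
  induction π with
  | nil => intro p; rfl
  | cons a π ih =>
    intro p
    exact congrArg (fun x => c p.1 a + x) (ih (stepP δ L step p a))

/-- Admissibility of the max-min heuristic (Lemma 1): assuming `N ≥ 1`, for every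
product state `(s, q)` and every plan `π` that drives the full product from `(s, q)`
to a fully accepting product state, `h (s, q)` is at most the total cost of `π`. -/
theorem maxMin_heuristic_admissible {S A α : Type*} {N : ℕ} {Q : Fin N → Type*}
    (hN : 1 ≤ N)
    (δ : S → A → S) (L : S → α) (c : S → A → ℝ≥0)
    (step : ∀ i, Q i → α → Q i) (F : ∀ i, Set (Q i))
    (s : S) (q : ∀ i, Q i) (π : List A)
    (hacc : ∀ i, (runP δ L step (s, q) π).2 i ∈ F i) :
    maxMinHeuristic δ L c step F (s, q) ≤ costP δ L c step (s, q) π := by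
  refine Finset.sup_le fun j _ => ?_
  refine csInf_le (OrderBot.bddBelow _) ⟨π, ?_, cost1_eq_costP δ L c step j π (s, q)⟩
  have h := run1_eq_runP δ L step j π (s, q)
  rw [h]
  exact hacc j

end Stmt3
end

section
/- Soundness of preference pruning (Line 12 of Algorithm 1): let μ : (Fin N → ℝ≥0) → ℝ≥0 be a preference function that is monotone with respect to the componentwise order, and let μ_max ∈ ℝ≥0 be a preference-cost bound. If a plan π from product state p_0 has μ applied to its PCS (the vector of gated task costs) strictly greater than μ_max, then every extension π ++ π' also has μ applied to its PCS strictly greater than μ_max; hence no extension of π satisfies the preference constraint. -/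
open scoped NNReal
open Classical

namespace Stmt8

/-- Product step on `S × (Π i, Q i)`. -/
def stepP {S A α : Type*} {N : ℕ} {Q : Fin N → Type*}
    (δ : S → A → S) (L : S → α) (step : ∀ i, Q i → α → Q i)
    (p : S × (∀ i, Q i)) (a : A) : S × (∀ i, Q i) :=
  (δ p.1 a, fun i => step i (p.2 i) (L (δ p.1 a)))

/-- The `i`-th gated task cost of a plan from a product state. -/
noncomputable def gcost {S A α : Type*} {N : ℕ} {Q : Fin N → Type*}
    (δ : S → A → S) (L : S → α) (c : S → A → ℝ≥0)
    (step : ∀ i, Q i → α → Q i) (F : ∀ i, Set (Q i)) (i : Fin N) :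
    (S × (∀ i, Q i)) → List A → ℝ≥0
  | _, [] => 0
  | p, a :: π =>
      (if p.2 i ∉ F i then c p.1 a else 0) + gcost δ L c step F i (stepP δ L step p a) π

/-- The preference cost set (PCS) of a plan from a product state: the vector of gated
task costs. -/
noncomputable def PCS {S A α : Type*} {N : ℕ} {Q : Fin N → Type*}
    (δ : S → A → S) (L : S → α) (c : S → A → ℝ≥0)
    (step : ∀ i, Q i → α → Q i) (F : ∀ i, Set (Q i))
    (p0 : S × (∀ i, Q i)) (π : List A) : Fin N → ℝ≥0 :=
  fun i => gcost δ L c step F i p0 π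

theorem gcost_le_append {S A α : Type*} {N : ℕ} {Q : Fin N → Type*}
    (δ : S → A → S) (L : S → α) (c : S → A → ℝ≥0)
    (step : ∀ i, Q i → α → Q i) (F : ∀ i, Set (Q i)) (i : Fin N) (π' π : List A) :
    ∀ p : S × (∀ i, Q i), gcost δ L c step F i p π ≤ gcost δ L c step F i p (π ++ π') := by
  induction π with
  | nil => intro p; simp [gcost]
  | cons a π ih =>
    intro p
    simp only [List.cons_append, gcost]
    exact add_le_add le_rfl (ih _)

/-- Soundness of preference pruning: if `μ` is monotone w.r.t. the componentwise order
and `μ (PCS π) > μ_max`, then every extension `π ++ π'` also has `μ (PCS (π ++ π')) > μ_max`. -/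
theorem preference_pruning_sound {S A α : Type*} {N : ℕ} {Q : Fin N → Type*}
    (δ : S → A → S) (L : S → α) (c : S → A → ℝ≥0)
    (step : ∀ i, Q i → α → Q i) (F : ∀ i, Set (Q i))
    (μ : (Fin N → ℝ≥0) → ℝ≥0)
    (hmono : ∀ v w : Fin N → ℝ≥0, (∀ i, v i ≤ w i) → μ v ≤ μ w)
    (μmax : ℝ≥0) (p0 : S × (∀ i, Q i)) (π : List A)
    (h : μmax < μ (PCS δ L c step F p0 π)) :
    ∀ π' : List A, μmax < μ (PCS δ L c step F p0 (π ++ π')) := by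
  intro π'
  exact lt_of_lt_of_le h (hmono _ _ fun i => gcost_le_append δ L c step F i π' π p0)

end Stmt8
end

section
/- Existence of a cost-optimal preference-constrained plan: assume S, A, and every Q_i are finite, and all transition costs are strictly positive (c s a > 0 for all s, a). Let μ : (Fin N → ℝ≥0) → ℝ≥0 be any preference function and μ_max ∈ ℝ≥0. If there exists a plan from the initial product state p_0 that reaches a fully accepting product state and whose PCS has μ-value at most μ_max, then there exists such a plan π* of minimum total cost: for every plan π from p_0 reaching a fully accepting state with μ(PCS(π)) ≤ μ_max, the total cost of π* is at most the total cost of π. -/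
open scoped NNReal
open Classical

namespace Stmt9

/-- Product step on `S × (Π i, Q i)`. -/
def stepP {S A α : Type*} {N : ℕ} {Q : Fin N → Type*}
    (δ : S → A → S) (L : S → α) (step : ∀ i, Q i → α → Q i)
    (p : S × (∀ i, Q i)) (a : A) : S × (∀ i, Q i) :=
  (δ p.1 a, fun i => step i (p.2 i) (L (δ p.1 a)))

/-- Executing a plan from a product state. -/
def runP {S A α : Type*} {N : ℕ} {Q : Fin N → Type*}
    (δ : S → A → S) (L : S → α) (step : ∀ i, Q i → α → Q i)
    (p : S × (∀ i, Q i)) (π : List A) : S × (∀ i, Q i) :=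
  π.foldl (stepP δ L step) p

/-- Total cost of executing a plan from a product state. -/
def costP {S A α : Type*} {N : ℕ} {Q : Fin N → Type*}
    (δ : S → A → S) (L : S → α) (c : S → A → ℝ≥0) (step : ∀ i, Q i → α → Q i) :
    (S × (∀ i, Q i)) → List A → ℝ≥0
  | _, [] => 0
  | p, a :: π => c p.1 a + costP δ L c step (stepP δ L step p a) π

/-- The `i`-th gated task cost of a plan from a product state. -/
noncomputable def gcost {S A α : Type*} {N : ℕ} {Q : Fin N → Type*}
    (δ : S → A → S) (L : S → α) (c : S → A → ℝ≥0)
    (step : ∀ i, Q i → α → Q i) (F : ∀ i, Set (Q i)) (i : Fin N) :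
    (S × (∀ i, Q i)) → List A → ℝ≥0
  | _, [] => 0
  | p, a :: π =>
      (if p.2 i ∉ F i then c p.1 a else 0) + gcost δ L c step F i (stepP δ L step p a) π

/-- The preference cost set (PCS) of a plan from a product state. -/
noncomputable def PCS {S A α : Type*} {N : ℕ} {Q : Fin N → Type*}
    (δ : S → A → S) (L : S → α) (c : S → A → ℝ≥0)
    (step : ∀ i, Q i → α → Q i) (F : ∀ i, Set (Q i))
    (p0 : S × (∀ i, Q i)) (π : List A) : Fin N → ℝ≥0 :=
  fun i => gcost δ L c step F i p0 π

/-- Total cost dominates `ε` times the plan length. -/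
theorem length_mul_le_costP {S A α : Type*} {N : ℕ} {Q : Fin N → Type*}
    (δ : S → A → S) (L : S → α) (c : S → A → ℝ≥0) (step : ∀ i, Q i → α → Q i)
    (ε : ℝ≥0) (h : ∀ s a, ε ≤ c s a) (π : List A) (p : S × (∀ i, Q i)) :
    (π.length : ℝ≥0) * ε ≤ costP δ L c step p π := by
  induction π generalizing p with
  | nil => simp
  | cons a π ih =>
    rw [costP, List.length_cons, Nat.cast_succ, add_mul, one_mul, add_comm]
    exact add_le_add (h _ _) (ih _)

/-- Existence of a cost-optimal preference-constrained plan: with finite `S`, `A`, `Q i`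
and strictly positive transition costs, if some plan from `p₀` reaches a fully accepting
product state with `μ (PCS) ≤ μ_max`, then there is such a plan of minimum total cost. -/
theorem exists_cost_optimal_constrained_plan {S A α : Type*} {N : ℕ} {Q : Fin N → Type*}
    [Fintype S] [Fintype A] [∀ i, Fintype (Q i)]
    (δ : S → A → S) (L : S → α) (c : S → A → ℝ≥0)
    (step : ∀ i, Q i → α → Q i) (F : ∀ i, Set (Q i))
    (hpos : ∀ (s : S) (a : A), 0 < c s a)
    (μ : (Fin N → ℝ≥0) → ℝ≥0) (μmax : ℝ≥0) (p0 : S × (∀ i, Q i))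
    (hex : ∃ π : List A,
      (∀ i, (runP δ L step p0 π).2 i ∈ F i) ∧ μ (PCS δ L c step F p0 π) ≤ μmax) :
    ∃ πstar : List A,
      (∀ i, (runP δ L step p0 πstar).2 i ∈ F i) ∧
      μ (PCS δ L c step F p0 πstar) ≤ μmax ∧
      ∀ π : List A,
        (∀ i, (runP δ L step p0 π).2 i ∈ F i) → μ (PCS δ L c step F p0 π) ≤ μmax →
        costP δ L c step p0 πstar ≤ costP δ L c step p0 π := by
  obtain ⟨ε, hε, hle⟩ : ∃ ε : ℝ≥0, 0 < ε ∧ ∀ s a, ε ≤ c s a := by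
    rcases isEmpty_or_nonempty (S × A) with h | h
    · exact ⟨1, one_pos, fun s a => (h.false (s, a)).elim⟩
    · obtain ⟨x, hx⟩ := Finite.exists_min (fun x : S × A => c x.1 x.2)
      exact ⟨c x.1 x.2, hpos _ _, fun s a => hx (s, a)⟩
  obtain ⟨π₀, h1, h2⟩ := hex
  obtain ⟨n, hn⟩ := exists_nat_ge (costP δ L c step p0 π₀ / ε)
  have key : ∀ π : List A, costP δ L c step p0 π ≤ costP δ L c step p0 π₀ → π.length ≤ n := by
    intro π hπ
    have h3 := (length_mul_le_costP δ L c step ε hle π p0).trans hπ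
    have h4 := ((le_div_iff₀ hε).2 h3).trans hn
    exact_mod_cast h4
  have hfin : ({π : List A | π.length ≤ n} ∩ {π | (∀ i, (runP δ L step p0 π).2 i ∈ F i) ∧
      μ (PCS δ L c step F p0 π) ≤ μmax}).Finite :=
    (List.finite_length_le A n).inter_of_left _
  obtain ⟨πs, ⟨-, hs1, hs2⟩, hmin⟩ := Set.exists_min_image _ (costP δ L c step p0) hfin
    ⟨π₀, key _ le_rfl, h1, h2⟩
  refine ⟨πs, hs1, hs2, fun π h3 h4 => ?_⟩
  rcases le_total (costP δ L c step p0 π) (costP δ L c step p0 π₀) with h | h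
  · exact hmin π ⟨key _ h, h3, h4⟩
  · exact (hmin π₀ ⟨key _ le_rfl, h1, h2⟩).trans h

end Stmt9
end
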